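/- Let p, q ∈ ℂ with 0 < |p| < 1, 0 < |q| < 1, and suppose p and q are incommensurate, i.e. p^j = q^k with j, k ∈ ℤ implies j = k = 0. Let N ≥ 1 and t₁, …, t_N, w₁, …, w_N ∈ ℂ ∖ {0} with t₁⋯t_N = w₁⋯w_N (the balancing condition). If D is a meromorphic function on ℂ ∖ {0} satisfying, as identities of meromorphic functions, D(qx) = [∏_{k=1}^{N} θ(t_k x;p)/θ(w_k x;p)]·D(x) and D(px) = [∏_{k=1}^{N} θ(t_k x;q)/θ(w_k x;q)]·D(x), then there is a constant c ∈ ℂ such that D(x) = c·∏_{k=1}^{N} Γ(t_k x;p,q)/Γ(w_k x;p,q). In particular, the pair of equations determines the elliptic hypergeometric term D uniquely up to a multiplicative constant. -/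

import Mathlib

open scoped BigOperators

/-- The infinite q-Pochhammer symbol `(x;p)_∞ = ∏_{j≥0} (1 - x p^j)`. -/
noncomputable def pochInf (x p : ℂ) : ℂ := ∏' j : ℕ, (1 - x * p ^ j)

/-- The theta function `θ(x;p) = (x;p)_∞ (p x⁻¹;p)_∞`. -/
noncomputable def theta (x p : ℂ) : ℂ := pochInf x p * pochInf (p * x⁻¹) p

/-- The elliptic gamma function `Γ(z;p,q)`. -/
noncomputable def ellGamma (z p q : ℂ) : ℂ :=
  ∏' jk : ℕ × ℕ, (1 - z⁻¹ * p ^ (jk.1 + 1) * q ^ (jk.2 + 1)) / (1 - z * p ^ jk.1 * q ^ jk.2)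

/-- The double product `∏_{j,k} (1 - z p^j q^k)`. -/
noncomputable def dblProd (p q z : ℂ) : ℂ := ∏' jk : ℕ × ℕ, (1 - z * p ^ jk.1 * q ^ jk.2)

lemma summable_geom_pair {p q : ℂ} (hp1 : ‖p‖ < 1) (hq1 : ‖q‖ < 1) :
    Summable (fun jk : ℕ × ℕ => ‖p‖ ^ jk.1 * ‖q‖ ^ jk.2) :=
  (summable_geometric_of_lt_one (norm_nonneg p) hp1).mul_of_nonneg
    (summable_geometric_of_lt_one (norm_nonneg q) hq1)
    (fun _ => by positivity) (fun _ => by positivity)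

lemma summable_dbl {p q : ℂ} (hp1 : ‖p‖ < 1) (hq1 : ‖q‖ < 1) (z : ℂ) :
    Summable (fun jk : ℕ × ℕ => ‖-(z * p ^ jk.1 * q ^ jk.2)‖) := by
  refine ((summable_geom_pair hp1 hq1).mul_left ‖z‖).congr fun jk => ?_
  simp [mul_assoc]

lemma multipliable_dbl {p q : ℂ} (hp1 : ‖p‖ < 1) (hq1 : ‖q‖ < 1) (z : ℂ) :
    Multipliable (fun jk : ℕ × ℕ => 1 - z * p ^ jk.1 * q ^ jk.2) := by
  simpa [sub_eq_add_neg] using multipliable_one_add_of_summable (summable_dbl hp1 hq1 z)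

lemma dblProd_ne_zero {p q : ℂ} (hp1 : ‖p‖ < 1) (hq1 : ‖q‖ < 1) {z : ℂ}
    (h : ∀ j k : ℕ, 1 - z * p ^ j * q ^ k ≠ 0) : dblProd p q z ≠ 0 := by
  have := tprod_one_add_ne_zero_of_summable
    (f := fun jk : ℕ × ℕ => -(z * p ^ jk.1 * q ^ jk.2))
    (fun i => by simpa [sub_eq_add_neg] using h i.1 i.2) (summable_dbl hp1 hq1 z)
  simpa [dblProd, sub_eq_add_neg] using this

lemma dblProd_symm (p q z : ℂ) : dblProd p q z = dblProd q p z := by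
  unfold dblProd
  rw [← (Equiv.prodComm ℕ ℕ).tprod_eq]
  refine tprod_congr fun jk => ?_
  simp only [Equiv.prodComm_apply, Prod.fst_swap, Prod.snd_swap]
  ring

lemma dblProd_differentiable {p q : ℂ} (hp1 : ‖p‖ < 1) (hq1 : ‖q‖ < 1) :
    Differentiable ℂ (dblProd p q) := by
  intro z
  have key := Summable.hasProdLocallyUniformlyOn_one_add (K := Metric.ball (0 : ℂ) (‖z‖ + 1))
    (f := fun (jk : ℕ × ℕ) (x : ℂ) => -(x * p ^ jk.1 * q ^ jk.2))
    (u := fun jk => (‖z‖ + 1) * (‖p‖ ^ jk.1 * ‖q‖ ^ jk.2))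
    Metric.isOpen_ball ((summable_geom_pair hp1 hq1).mul_left _)
    (Filter.Eventually.of_forall fun jk x hx => by
      have hx' : ‖x‖ ≤ ‖z‖ + 1 := by simpa using (mem_ball_zero_iff.1 hx).le
      simp only [norm_neg, norm_mul, norm_pow, mul_assoc]
      gcongr)
    (fun jk => by fun_prop)
  rw [hasProdLocallyUniformlyOn_iff_tendstoLocallyUniformlyOn] at key
  have hd := key.differentiableOn (Filter.Eventually.of_forall fun s => by fun_prop)
    Metric.isOpen_ball
  have he : dblProd p q = fun x => ∏' jk : ℕ × ℕ, (1 + -(x * p ^ jk.1 * q ^ jk.2)) := by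
    funext x; simp [dblProd, sub_eq_add_neg]
  rw [he]
  exact hd.differentiableAt (Metric.isOpen_ball.mem_nhds (by simp))

lemma multipliable_poch {p : ℂ} (hp1 : ‖p‖ < 1) (z : ℂ) :
    Multipliable (fun j : ℕ => 1 - z * p ^ j) := by
  have : Summable (fun j : ℕ => ‖-(z * p ^ j)‖) := by
    refine ((summable_geometric_of_lt_one (norm_nonneg p) hp1).mul_left ‖z‖).congr fun j => ?_
    simp
  simpa [sub_eq_add_neg] using multipliable_one_add_of_summable this

lemma dblProd_step {p q : ℂ} (hp1 : ‖p‖ < 1) (hq1 : ‖q‖ < 1) (z : ℂ) :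
    dblProd p q z = pochInf z p * dblProd p q (q * z) := by
  have key : ∀ x : ℂ, HasProd (fun k : ℕ => pochInf (x * q ^ k) p) (dblProd p q x) := by
    intro x
    have h := (multipliable_dbl hq1 hp1 x).hasProd.prod_fiberwise
      (g := fun k : ℕ => pochInf (x * q ^ k) p)
      (fun k => (multipliable_poch hp1 (x * q ^ k)).hasProd)
    rw [dblProd_symm]
    exact h
  have h1 := key z
  have h2 := key (q * z)
  have e : (fun k : ℕ => pochInf (q * z * q ^ k) p) = fun k => pochInf (z * q ^ (k + 1)) p := by
    funext k; congr 1; ring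
  rw [e] at h2
  have h3 := tprod_eq_zero_mul' (f := fun k : ℕ => pochInf (z * q ^ k) p) h2.multipliable
  rw [h1.tprod_eq, h2.tprod_eq] at h3
  simpa using h3

lemma ellGamma_eq {p q : ℂ} (hp1 : ‖p‖ < 1) (hq1 : ‖q‖ < 1) (z : ℂ) :
    ellGamma z p q = dblProd p q (p * q * z⁻¹) / dblProd p q z := by
  by_cases h : ∀ j k : ℕ, 1 - z * p ^ j * q ^ k ≠ 0
  · have h1 := (multipliable_dbl hp1 hq1 (p * q * z⁻¹)).hasProd
    have h2 := (multipliable_dbl hp1 hq1 z).hasProd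
    have h3 := Filter.Tendsto.div h1 h2 (dblProd_ne_zero hp1 hq1 h)
    refine HasProd.tprod_eq ?_
    refine Filter.Tendsto.congr (fun s => ?_) h3
    simp only [Pi.div_apply]
    rw [← Finset.prod_div_distrib]
    refine Finset.prod_congr rfl fun jk _ => ?_
    congr 2; ring
  · push Not at h
    obtain ⟨j, k, h⟩ := h
    have h0 : dblProd p q z = 0 := tprod_of_exists_eq_zero ⟨(j, k), h⟩
    rw [h0, div_zero]
    exact tprod_of_exists_eq_zero ⟨(j, k), by simp [h]⟩

lemma ellGamma_symm {p q : ℂ} (hp1 : ‖p‖ < 1) (hq1 : ‖q‖ < 1) (z : ℂ) :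
    ellGamma z p q = ellGamma z q p := by
  rw [ellGamma_eq hp1 hq1, ellGamma_eq hq1 hp1, dblProd_symm p q z, dblProd_symm p q, mul_comm p q]

/-- The lattice `p^ℤ q^ℤ`. -/
def lat (p q : ℂ) : Set ℂ := Set.range fun ab : ℤ × ℤ => p ^ ab.1 * q ^ ab.2

lemma lat_symm (p q : ℂ) : lat p q ⊆ lat q p := by
  rintro _ ⟨⟨a, b⟩, rfl⟩
  exact ⟨(b, a), mul_comm _ _⟩

lemma dblProd_ne_zero_of_lat {p q : ℂ} (hp1 : ‖p‖ < 1) (hq1 : ‖q‖ < 1)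
    {z : ℂ} (hz : z ∉ lat p q) : dblProd p q z ≠ 0 := by
  refine dblProd_ne_zero hp1 hq1 fun j k h => hz ⟨(-j, -k), ?_⟩
  have h1 : z * (p ^ j * q ^ k) = 1 := by rw [← mul_assoc]; exact (sub_eq_zero.1 h).symm
  simp only [zpow_neg, zpow_natCast, ← mul_inv]
  exact (eq_inv_of_mul_eq_one_left h1).symm

lemma inv_not_lat {p q : ℂ} (hp0 : p ≠ 0) (hq0 : q ≠ 0) {z : ℂ} (hz : z ∉ lat p q) (m n : ℤ) :
    p ^ m * q ^ n * z⁻¹ ∉ lat p q := by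
  rintro ⟨⟨a, b⟩, h⟩
  apply hz
  refine ⟨(m - a, n - b), ?_⟩
  simp only at h ⊢
  have hz' : z⁻¹ = p ^ a * q ^ b / (p ^ m * q ^ n) := by
    rw [h]; field_simp
  rw [← inv_inv z, hz', zpow_sub₀ hp0, zpow_sub₀ hq0]
  field_simp

lemma theta_ne_zero {p q : ℂ} (hp0 : p ≠ 0) (hq0 : q ≠ 0) (hp1 : ‖p‖ < 1) (hq1 : ‖q‖ < 1) {z : ℂ}
    (hz : z ∉ lat p q) : theta z p ≠ 0 := by
  have h1 := dblProd_ne_zero_of_lat hp1 hq1 hz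
  have h2 := dblProd_ne_zero_of_lat hp1 hq1 (inv_not_lat hp0 hq0 hz 1 0)
  rw [dblProd_step hp1 hq1] at h1 h2
  simp only [zpow_one, zpow_zero, mul_one] at h2
  exact mul_ne_zero (left_ne_zero_of_mul h1) (left_ne_zero_of_mul h2)

lemma ellGamma_ne_zero {p q : ℂ} (hp0 : p ≠ 0) (hq0 : q ≠ 0) (hp1 : ‖p‖ < 1) (hq1 : ‖q‖ < 1)
    {z : ℂ} (hz : z ∉ lat p q) : ellGamma z p q ≠ 0 := by
  have h1 := dblProd_ne_zero_of_lat hp1 hq1 hz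
  have h2 := dblProd_ne_zero_of_lat hp1 hq1 (inv_not_lat hp0 hq0 hz 1 1)
  simp only [zpow_one] at h2
  rw [ellGamma_eq hp1 hq1]
  exact div_ne_zero h2 h1

lemma ellGamma_step {p q : ℂ} (hq0 : q ≠ 0) (hp1 : ‖p‖ < 1) (hq1 : ‖q‖ < 1)
    {z : ℂ} (hz : z ∉ lat p q) : ellGamma (q * z) p q = theta z p * ellGamma z p q := by
  have h1 := dblProd_ne_zero_of_lat hp1 hq1 hz
  rw [ellGamma_eq hp1 hq1, ellGamma_eq hp1 hq1]
  have e1 : p * q * (q * z)⁻¹ = p * z⁻¹ := by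
    rw [mul_inv]; field_simp
  have e2 := dblProd_step hp1 hq1 (p * z⁻¹)
  have e3 := dblProd_step hp1 hq1 z
  rw [e3] at h1
  have h4 := left_ne_zero_of_mul h1
  have h5 := right_ne_zero_of_mul h1
  have e4 : q * (p * z⁻¹) = p * q * z⁻¹ := by ring
  rw [e1, e2, e3, e4, theta]
  field_simp

lemma ellGamma_step' {p q : ℂ} (hp0 : p ≠ 0) (hp1 : ‖p‖ < 1) (hq1 : ‖q‖ < 1)
    {z : ℂ} (hz : z ∉ lat p q) : ellGamma (p * z) p q = theta z q * ellGamma z p q := by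
  rw [ellGamma_symm hp1 hq1, ellGamma_symm hp1 hq1]
  exact ellGamma_step hp0 hq1 hp1 fun h => hz (lat_symm _ _ h)

lemma ellGamma_meromorphicAt {p q : ℂ} (hp1 : ‖p‖ < 1) (hq1 : ‖q‖ < 1) {t z : ℂ}
    (ht : t ≠ 0) (hz : z ≠ 0) : MeromorphicAt (fun x => ellGamma (t * x) p q) z := by
  have hA : ∀ y, AnalyticAt ℂ (dblProd p q) y := fun y =>
    (dblProd_differentiable hp1 hq1).analyticAt y
  have h : (fun x => ellGamma (t * x) p q) =
      fun x => dblProd p q (p * q * (t * x)⁻¹) / dblProd p q (t * x) := by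
    funext x; exact ellGamma_eq hp1 hq1 _
  rw [h]
  have hin : AnalyticAt ℂ (fun x : ℂ => p * q * (t * x)⁻¹) z :=
    analyticAt_const.mul ((analyticAt_const.mul analyticAt_id).inv (mul_ne_zero ht hz))
  have hin2 : AnalyticAt ℂ (fun x : ℂ => t * x) z := analyticAt_const.mul analyticAt_id
  exact ((hA _).fun_comp hin).meromorphicAt.div ((hA _).fun_comp hin2).meromorphicAt

lemma countable_preimage_mul {s : Set ℂ} (hs : s.Countable) {t : ℂ} (ht : t ≠ 0) :
    {x : ℂ | t * x ∈ s}.Countable :=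
  hs.preimage_of_injOn (f := fun x => t * x) (mul_right_injective₀ ht).injOn

/-- A meromorphic function on `ℂ ∖ {0}` with incommensurate multiplicative periods is constant. -/
lemma const_of_periods (p q : ℂ) (hp0 : p ≠ 0) (hq0 : q ≠ 0) (hq1 : ‖q‖ < 1)
    (hinc : ∀ j k : ℤ, p ^ j = q ^ k → j = 0 ∧ k = 0)
    (F : ℂ → ℂ) (hF : ∀ z : ℂ, z ≠ 0 → MeromorphicAt F z)
    (hq : {x : ℂ | x ≠ 0 ∧ F (q * x) ≠ F x}.Countable)
    (hp : {x : ℂ | x ≠ 0 ∧ F (p * x) ≠ F x}.Countable) :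
    ∃ c : ℂ, {x : ℂ | x ≠ 0 ∧ F x ≠ c}.Countable := by
  -- a generic point
  obtain ⟨x₀, hx₀⟩ : ∃ x₀ : ℂ, x₀ ∉ ({0} ∪ ⋃ ab : ℤ × ℤ, {x : ℂ | p ^ ab.1 * q ^ ab.2 * x ∈
      {x : ℂ | x ≠ 0 ∧ F (q * x) ≠ F x} ∪ {x : ℂ | x ≠ 0 ∧ F (p * x) ≠ F x}} : Set ℂ) := by
    have hc : ({0} ∪ ⋃ ab : ℤ × ℤ, {x : ℂ | p ^ ab.1 * q ^ ab.2 * x ∈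
      {x : ℂ | x ≠ 0 ∧ F (q * x) ≠ F x} ∪ {x : ℂ | x ≠ 0 ∧ F (p * x) ≠ F x}} :
        Set ℂ).Countable := by
      refine (Set.countable_singleton 0).union (Set.countable_iUnion fun ab => ?_)
      exact countable_preimage_mul (hq.union hp)
        (mul_ne_zero (zpow_ne_zero _ hp0) (zpow_ne_zero _ hq0))
    by_contra hcon
    push Not at hcon
    exact not_countable_complex (hc.mono fun x _ => hcon x)
  simp only [Set.mem_union, Set.mem_singleton_iff, Set.mem_iUnion, Set.mem_ofPred_eq, not_or,
    not_exists] at hx₀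
  obtain ⟨hx0, hx₀⟩ := hx₀
  have hne : ∀ a b : ℤ, p ^ a * q ^ b * x₀ ≠ 0 := fun a b =>
    mul_ne_zero (mul_ne_zero (zpow_ne_zero _ hp0) (zpow_ne_zero _ hq0)) hx0
  have sq : ∀ a b : ℤ, F (p ^ a * q ^ (b + 1) * x₀) = F (p ^ a * q ^ b * x₀) := by
    intro a b
    have h := (hx₀ (a, b)).1
    simp only [ne_eq, hne a b, not_false_eq_true, true_and, not_not] at h
    rw [← h, zpow_add_one₀ hq0]; congr 1; ring
  have sp : ∀ a b : ℤ, F (p ^ (a + 1) * q ^ b * x₀) = F (p ^ a * q ^ b * x₀) := by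
    intro a b
    have h := (hx₀ (a, b)).2
    simp only [ne_eq, hne a b, not_false_eq_true, true_and, not_not] at h
    rw [← h, zpow_add_one₀ hp0]; congr 1; ring
  have hq' : ∀ a b : ℤ, F (p ^ a * q ^ b * x₀) = F (p ^ a * q ^ (0 : ℤ) * x₀) := by
    intro a b
    induction b using Int.induction_on with
    | zero => rfl
    | succ i ih => rw [sq, ih]
    | pred i ih => rw [← ih, ← sq a (-i - 1)]; simp
  have hp' : ∀ a : ℤ, F (p ^ a * q ^ (0 : ℤ) * x₀) = F x₀ := by
    intro a
    induction a using Int.induction_on with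
    | zero => simp
    | succ i ih => rw [sp, ih]
    | pred i ih => rw [← ih, ← sp (-i - 1) 0]; simp
  have hconst : ∀ a b : ℤ, F (p ^ a * q ^ b * x₀) = F x₀ := fun a b => (hq' a b).trans (hp' a)
  -- an infinite family in an annulus
  have hqn : 0 < ‖q‖ := norm_pos_iff.2 hq0
  have hex : ∀ n : ℕ, ∃ m : ℤ, ‖p ^ (n : ℤ)‖ ∈ Set.Ico ((‖q‖⁻¹) ^ m) ((‖q‖⁻¹) ^ (m + 1)) :=
    fun n => exists_mem_Ico_zpow (norm_pos_iff.2 (zpow_ne_zero _ hp0)) ((one_lt_inv₀ hqn).2 hq1)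
  choose m hm using hex
  let g : ℕ → ℂ := fun n => p ^ (n : ℤ) * q ^ (m n) * x₀
  have ginj : Function.Injective g := by
    intro a b hab
    have h1 : p ^ (a : ℤ) * q ^ (m a) = p ^ (b : ℤ) * q ^ (m b) := mul_right_cancel₀ hx0 hab
    have h2 : p ^ ((a : ℤ) - b) = q ^ (m b - m a) := by
      rw [zpow_sub₀ hp0, zpow_sub₀ hq0, div_eq_div_iff (zpow_ne_zero _ hp0) (zpow_ne_zero _ hq0),
        h1]
      ring
    have := (hinc _ _ h2).1
    omega
  have hK : IsCompact (Metric.closedBall (0 : ℂ) (‖q‖⁻¹ * ‖x₀‖) \ Metric.ball 0 ‖x₀‖) :=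
    (isCompact_closedBall _ _).diff Metric.isOpen_ball
  have hsub : Set.range g ⊆ Metric.closedBall (0 : ℂ) (‖q‖⁻¹ * ‖x₀‖) \ Metric.ball 0 ‖x₀‖ := by
    rintro _ ⟨n, rfl⟩
    obtain ⟨h1, h2⟩ := hm n
    have hqm : 0 < ‖q‖ ^ m n := zpow_pos hqn _
    have hgn : ‖g n‖ = ‖p ^ (n : ℤ)‖ * ‖q‖ ^ m n * ‖x₀‖ := by
      simp only [g, norm_mul, norm_zpow]
    have l1 : 1 ≤ ‖p ^ (n : ℤ)‖ * ‖q‖ ^ m n := by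
      have := mul_le_mul_of_nonneg_right h1 hqm.le
      rwa [inv_zpow, inv_mul_cancel₀ hqm.ne'] at this
    have l2 : ‖p ^ (n : ℤ)‖ * ‖q‖ ^ m n ≤ ‖q‖⁻¹ := by
      have := mul_le_mul_of_nonneg_right h2.le hqm.le
      rw [zpow_add_one₀ (inv_ne_zero hqn.ne'), inv_zpow] at this
      refine this.trans (le_of_eq ?_)
      field_simp
    simp only [Set.mem_sdiff, mem_closedBall_zero_iff, mem_ball_zero_iff, not_lt, hgn]
    exact ⟨mul_le_mul_of_nonneg_right l2 (norm_nonneg _),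
      le_mul_of_one_le_left (norm_nonneg _) l1⟩
  obtain ⟨y, hyK, hy⟩ :=
    (Set.infinite_range_of_injective ginj).exists_accPt_of_subset_isCompact hK hsub
  have hy0 : y ≠ 0 := by
    rintro rfl
    apply hyK.2
    simpa using hx0
  -- identity theorem
  refine ⟨F x₀, ?_⟩
  set H : ℂ → ℂ := fun x => F x - F x₀ with hH
  have hHm : MeromorphicOn H {0}ᶜ := fun z hz => (hF z hz).sub (MeromorphicAt.const _ _)
  have hytop : meromorphicOrderAt H y = ⊤ := by
    rw [meromorphicOrderAt_eq_top_iff]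
    rcases (hHm y hy0).eventually_eq_zero_or_eventually_ne_zero with h | h
    · exact h
    · exfalso
      rw [accPt_iff_frequently_nhdsNE] at hy
      refine hy (h.mono ?_)
      rintro z hz ⟨n, rfl⟩
      exact hz (by simp only [hH, g, hconst, sub_self])
  have hconn : IsPreconnected ({0}ᶜ : Set ℂ) :=
    (isConnected_compl_singleton_of_one_lt_rank (by simp) 0).isPreconnected
  have htop : ∀ z : ℂ, z ≠ 0 → ∀ᶠ x in nhdsWithin z {z}ᶜ, H x = 0 := by
    intro z hz
    rw [← meromorphicOrderAt_eq_top_iff]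
    by_contra hcon
    exact hHm.meromorphicOrderAt_ne_top_of_isPreconnected hconn (Set.mem_compl hz)
      (Set.mem_compl hy0) hcon hytop
  obtain ⟨T, -, hT, hcov⟩ := TopologicalSpace.countable_cover_nhdsWithin
    (s := {x : ℂ | x ≠ 0 ∧ F x ≠ F x₀}) (f := fun x => {x}) (by
      rintro x ⟨hx, -⟩
      have h := htop x hx
      rw [eventually_nhdsWithin_iff] at h
      rw [mem_nhdsWithin_iff_eventually]
      filter_upwards [h] with u hu hus
      by_contra hux
      exact hus.2 (sub_eq_zero.1 (hu hux)))
  refine hT.mono (hcov.trans ?_)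
  simp

/-- Uniqueness of the one-variable elliptic hypergeometric term: for
incommensurate bases `p,q`, a meromorphic solution on `ℂ ∖ {0}` of the pair of
`q`- and `p`-difference equations with balanced theta-function coefficients
(understood as identities of meromorphic functions, i.e. up to a countable
exceptional set) equals `c·∏_k Γ(t_k x;p,q)/Γ(w_k x;p,q)` up to a countable
exceptional set, for some constant `c`. -/
theorem elliptic_term_uniqueness (p q : ℂ)
    (hp0 : 0 < ‖p‖) (hp1 : ‖p‖ < 1)
    (hq0 : 0 < ‖q‖) (hq1 : ‖q‖ < 1)
    (hinc : ∀ j k : ℤ, p ^ j = q ^ k → j = 0 ∧ k = 0)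
    (N : ℕ) (hN : 1 ≤ N) (t w : Fin N → ℂ) (ht : ∀ k, t k ≠ 0) (hw : ∀ k, w k ≠ 0)
    (hbal : ∏ k, t k = ∏ k, w k)
    (D : ℂ → ℂ) (hD : ∀ z : ℂ, z ≠ 0 → MeromorphicAt D z)
    (heqq : {x : ℂ | x ≠ 0 ∧
      D (q * x) ≠ (∏ k, theta (t k * x) p / theta (w k * x) p) * D x}.Countable)
    (heqp : {x : ℂ | x ≠ 0 ∧
      D (p * x) ≠ (∏ k, theta (t k * x) q / theta (w k * x) q) * D x}.Countable) :
    ∃ c : ℂ, {x : ℂ | x ≠ 0 ∧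
      D x ≠ c * ∏ k, ellGamma (t k * x) p q / ellGamma (w k * x) p q}.Countable := by
  have hp : p ≠ 0 := norm_pos_iff.1 hp0
  have hq : q ≠ 0 := norm_pos_iff.1 hq0
  set G : ℂ → ℂ := fun x => ∏ k, ellGamma (t k * x) p q / ellGamma (w k * x) p q with hG
  set B : Set ℂ := ⋃ k, ({x | t k * x ∈ lat p q} ∪ {x | w k * x ∈ lat p q}) with hB
  have hlat : (lat p q).Countable := Set.countable_range _
  have hBc : B.Countable := Set.countable_iUnion fun k =>
    (countable_preimage_mul hlat (ht k)).union (countable_preimage_mul hlat (hw k))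
  have hnt : ∀ x, x ∉ B → ∀ k, t k * x ∉ lat p q := fun x hx k h =>
    hx (Set.mem_iUnion.2 ⟨k, Or.inl h⟩)
  have hnw : ∀ x, x ∉ B → ∀ k, w k * x ∉ lat p q := fun x hx k h =>
    hx (Set.mem_iUnion.2 ⟨k, Or.inr h⟩)
  have hG0 : ∀ x, x ∉ B → G x ≠ 0 := fun x hx => Finset.prod_ne_zero_iff.2 fun k _ =>
    div_ne_zero (ellGamma_ne_zero hp hq hp1 hq1 (hnt x hx k))
      (ellGamma_ne_zero hp hq hp1 hq1 (hnw x hx k))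
  have hGm : ∀ z : ℂ, z ≠ 0 → MeromorphicAt G z := by
    intro z hz
    exact MeromorphicAt.fun_prod fun k _ =>
      (ellGamma_meromorphicAt hp1 hq1 (ht k) hz).div (ellGamma_meromorphicAt hp1 hq1 (hw k) hz)
  have hGq : ∀ x, x ∉ B →
      G (q * x) = (∏ k, theta (t k * x) p / theta (w k * x) p) * G x := by
    intro x hx
    simp only [hG]
    rw [← Finset.prod_mul_distrib]
    refine Finset.prod_congr rfl fun k _ => ?_
    rw [mul_left_comm (t k), mul_left_comm (w k), ellGamma_step hq hp1 hq1 (hnt x hx k),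
      ellGamma_step hq hp1 hq1 (hnw x hx k), mul_div_mul_comm]
  have hGp : ∀ x, x ∉ B →
      G (p * x) = (∏ k, theta (t k * x) q / theta (w k * x) q) * G x := by
    intro x hx
    simp only [hG]
    rw [← Finset.prod_mul_distrib]
    refine Finset.prod_congr rfl fun k _ => ?_
    rw [mul_left_comm (t k), mul_left_comm (w k), ellGamma_step' hp hp1 hq1 (hnt x hx k),
      ellGamma_step' hp hp1 hq1 (hnw x hx k), mul_div_mul_comm]
  have hθp : ∀ x, x ∉ B → (∏ k, theta (t k * x) p / theta (w k * x) p) ≠ 0 :=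
    fun x hx => Finset.prod_ne_zero_iff.2 fun k _ =>
    div_ne_zero (theta_ne_zero hp hq hp1 hq1 (hnt x hx k))
      (theta_ne_zero hp hq hp1 hq1 (hnw x hx k))
  have hθq : ∀ x, x ∉ B → (∏ k, theta (t k * x) q / theta (w k * x) q) ≠ 0 :=
    fun x hx => Finset.prod_ne_zero_iff.2 fun k _ =>
    div_ne_zero (theta_ne_zero hq hp hq1 hp1 fun h => hnt x hx k (lat_symm _ _ h))
      (theta_ne_zero hq hp hq1 hp1 fun h => hnw x hx k (lat_symm _ _ h))
  obtain ⟨c, hc⟩ := const_of_periods p q hp hq hq1 hinc (fun x => D x / G x)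
    (fun z hz => (hD z hz).div (hGm z hz))
    ((heqq.union hBc).mono (by
      rintro x ⟨hx, h⟩
      by_contra hcon
      simp only [Set.mem_union, Set.mem_ofPred_eq, not_or, not_and, not_not] at hcon
      exact h (by rw [hcon.1 hx, hGq x hcon.2, mul_div_mul_left _ _ (hθp x hcon.2)])))
    ((heqp.union hBc).mono (by
      rintro x ⟨hx, h⟩
      by_contra hcon
      simp only [Set.mem_union, Set.mem_ofPred_eq, not_or, not_and, not_not] at hcon
      exact h (by rw [hcon.1 hx, hGp x hcon.2, mul_div_mul_left _ _ (hθq x hcon.2)])))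
  refine ⟨c, (hc.union hBc).mono ?_⟩
  rintro x ⟨hx, h⟩
  by_contra hcon
  simp only [Set.mem_union, Set.mem_ofPred_eq, not_or, not_and, not_not] at hcon
  exact h ((div_eq_iff (hG0 x hcon.2)).1 (hcon.1 hx))
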